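/- If G is a graph in which every vertex has degree at least c·Δ for a constant c > 0, where Δ is the maximum degree, then χ_CN(G) = O(ln Δ); moreover there exist such graphs with χ_CN(G) = Ω(ln Δ), so f_CN(cΔ) = Θ(ln Δ). -/

import Mathlib

open Finset

/-- `f` is a CFON coloring of `G`: every vertex has a color appearing
exactly once in its open neighborhood. -/
def IsCFONColoring {V : Type} (G : SimpleGraph V) {k : ℕ} (f : V → Fin k) : Prop :=
  ∀ v : V, ∃ c : Fin k, ∃! u : V, u ∈ G.neighborSet v ∧ f u = c

/-- `f` is a CFCN coloring of `G`: every vertex has a color appearing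
exactly once in its closed neighborhood. -/
def IsCFCNColoring {V : Type} (G : SimpleGraph V) {k : ℕ} (f : V → Fin k) : Prop :=
  ∀ v : V, ∃ c : Fin k, ∃! u : V, u ∈ insert v (G.neighborSet v) ∧ f u = c

/-- The CFON chromatic number of `G`. -/
noncomputable def chiON {V : Type} [Fintype V] (G : SimpleGraph V) : ℕ :=
  sInf {k : ℕ | ∃ f : V → Fin k, IsCFONColoring G f}

/-- The CFCN chromatic number of `G`. -/
noncomputable def chiCN {V : Type} [Fintype V] (G : SimpleGraph V) : ℕ :=
  sInf {k : ℕ | ∃ f : V → Fin k, IsCFCNColoring G f}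

open Module in
lemma finrank_span_single_le {K W : Type*} [Field K] [AddCommGroup W] [Module K W] (w : W) :
    finrank K (Submodule.span K {w}) ≤ 1 := by
  simpa using finrank_span_le_card (R := K) ({w} : Set W)

open Module in
lemma rado_aux {K W ι : Type*} [Field K] [AddCommGroup W] [Module K W] [FiniteDimensional K W]
    [DecidableEq ι] [DecidableEq W] (C : ι → Set W) : ∀ (n : ℕ) (I : Finset ι), I.card = n →
    ∀ M : Submodule K W,
      (∀ J ⊆ I, finrank K M + J.card ≤
        finrank K (M ⊔ Submodule.span K (⋃ i ∈ J, C i) : Submodule K W)) →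
      ∃ t : ι → W, (∀ i ∈ I, t i ∈ C i) ∧
        finrank K M + I.card ≤
          finrank K (M ⊔ Submodule.span K (I.image t : Set W) : Submodule K W) := by
  intro n
  induction n using Nat.strong_induction_on with
  | _ n ih =>
  intro I hI M h
  rcases I.eq_empty_or_nonempty with rfl | hne
  · exact ⟨fun _ => 0, by simp, by
      rw [Finset.card_empty, add_zero]; exact Submodule.finrank_mono le_sup_left⟩
  by_cases hc : ∃ J ⊆ I, J ≠ I ∧ J.Nonempty ∧
      finrank K (M ⊔ Submodule.span K (⋃ i ∈ J, C i) : Submodule K W) ≤ finrank K M + J.card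
  · obtain ⟨J, hJI, hJne, hJ0, hJ⟩ := hc
    have hlt : J.card < n := hI ▸ Finset.card_lt_card (hJI.ssubset_of_ne hJne)
    obtain ⟨t1, ht1, hr1⟩ := ih _ hlt J rfl M (fun J' hJ' => h J' (hJ'.trans hJI))
    have hle : (M ⊔ Submodule.span K (J.image t1 : Set W)) ≤
        (M ⊔ Submodule.span K (⋃ i ∈ J, C i)) := by
      refine sup_le_sup_left (Submodule.span_mono ?_) _
      intro x hx
      simp only [Finset.coe_image, Set.mem_image, Finset.mem_coe] at hx
      obtain ⟨i, hi, rfl⟩ := hx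
      exact Set.mem_biUnion hi (ht1 i hi)
    have heq := Submodule.eq_of_le_of_finrank_le hle (hJ.trans hr1)
    have hcard : (I \ J).card + J.card = I.card := Finset.card_sdiff_add_card_eq_card hJI
    have hpos := hJ0.card_pos
    obtain ⟨t2, ht2, hr2⟩ := ih (I \ J).card (by omega) (I \ J) rfl
      (M ⊔ Submodule.span K (⋃ i ∈ J, C i)) (by
        intro J' hJ'
        have hd : Disjoint J J' := (Finset.disjoint_sdiff).mono_right hJ'
        have := h (J ∪ J') (Finset.union_subset hJI (hJ'.trans Finset.sdiff_subset))
        rw [Finset.card_union_of_disjoint hd, Finset.set_biUnion_union,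
          Submodule.span_union, ← sup_assoc] at this
        omega)
    refine ⟨fun i => if i ∈ J then t1 i else t2 i, ?_, ?_⟩
    · intro i hi
      by_cases hiJ : i ∈ J
      · simpa [hiJ] using ht1 i hiJ
      · simpa [hiJ] using ht2 i (by simp [hi, hiJ])
    · have him : I.image (fun i => if i ∈ J then t1 i else t2 i) =
          J.image t1 ∪ (I \ J).image t2 := by
        conv_lhs => rw [← Finset.union_sdiff_of_subset hJI]
        rw [Finset.image_union]
        congr 1
        · exact Finset.image_congr (fun i hi => by simp [Finset.mem_coe.1 hi])
        · exact Finset.image_congr (fun i hi => by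
            simp [(Finset.mem_sdiff.1 (Finset.mem_coe.1 hi)).2])
      rw [him, Finset.coe_union, Submodule.span_union, ← sup_assoc, heq]
      rw [heq] at hr1
      omega
  · push Not at hc
    obtain ⟨i, hi⟩ := hne
    have hex : ∃ w ∈ C i, w ∉ M := by
      by_contra hcon
      push Not at hcon
      have h1 := h {i} (by simpa using hi)
      have : Submodule.span K (⋃ j ∈ ({i} : Finset ι), C j) ≤ M := by
        rw [Submodule.span_le]; intro x hx; simp at hx; exact hcon x hx
      rw [sup_eq_left.2 this] at h1
      simp at h1
    obtain ⟨w, hwC, hwM⟩ := hex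
    have hM1 : finrank K (M ⊔ Submodule.span K {w} : Submodule K W) ≤ finrank K M + 1 := by
      refine (Submodule.finrank_add_le_finrank_add_finrank _ _).trans ?_
      have := finrank_span_single_le (K := K) w
      omega
    have hM2 : finrank K M < finrank K (M ⊔ Submodule.span K {w} : Submodule K W) := by
      apply Submodule.finrank_lt_finrank_of_lt
      refine lt_of_le_of_ne le_sup_left ?_
      intro he
      apply hwM
      rw [he]
      exact (le_sup_right : Submodule.span K {w} ≤ _) (Submodule.mem_span_singleton_self w)
    have hce : (I.erase i).card + 1 = I.card := Finset.card_erase_add_one hi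
    obtain ⟨t, ht, hr⟩ := ih (I.erase i).card (by omega) (I.erase i) rfl
      (M ⊔ Submodule.span K {w}) (by
        intro J hJ
        rcases J.eq_empty_or_nonempty with rfl | hJ0
        · simpa using Submodule.finrank_mono le_sup_left
        have h1 := hc J (hJ.trans (Finset.erase_subset _ _))
          (fun he => by rw [he] at hJ; exact Finset.notMem_erase i I (hJ hi)) hJ0
        have h2 : finrank K (M ⊔ Submodule.span K (⋃ i ∈ J, C i) : Submodule K W) ≤
          finrank K (M ⊔ Submodule.span K {w} ⊔ Submodule.span K (⋃ i ∈ J, C i) :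
            Submodule K W) :=
          Submodule.finrank_mono (sup_le_sup_right le_sup_left _)
        omega)
    refine ⟨fun j => if j = i then w else t j, ?_, ?_⟩
    · intro j hj
      by_cases hji : j = i
      · subst hji; simpa using hwC
      · simpa [hji] using ht j (by simp [hj, hji])
    · have him : I.image (fun j => if j = i then w else t j) =
          {w} ∪ (I.erase i).image t := by
        conv_lhs => rw [← Finset.insert_erase hi]
        rw [Finset.image_insert, Finset.insert_eq]
        congr 1
        · simp
        · exact Finset.image_congr (fun j hj => by
            simp [(Finset.mem_erase.1 (Finset.mem_coe.1 hj)).1])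
      rw [him, Finset.coe_union, Submodule.span_union, ← sup_assoc, Finset.coe_singleton]
      omega

open Module in
lemma finrank_sup_image_le {K W ι : Type*} [Field K] [AddCommGroup W] [Module K W]
    [FiniteDimensional K W] [DecidableEq W] (M : Submodule K W) (t : ι → W) (I : Finset ι) :
    finrank K (M ⊔ Submodule.span K (I.image t : Set W) : Submodule K W) ≤
      finrank K M + (I.image t).card := by
  refine (Submodule.finrank_add_le_finrank_add_finrank _ _).trans ?_
  have := finrank_span_finset_le_card (R := K) (I.image t)
  unfold Set.finrank at this
  omega

open Module in
lemma exists_dual_one {K W ι : Type*} [Field K] [AddCommGroup W] [Module K W]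
    [FiniteDimensional K W] [DecidableEq W] [DecidableEq ι] (M : Submodule K W) (t : ι → W)
    (I : Finset ι)
    (h : finrank K M + I.card ≤
      finrank K (M ⊔ Submodule.span K (I.image t : Set W) : Submodule K W)) :
    ∃ φ : W →ₗ[K] K, (∀ x ∈ M, φ x = 0) ∧ ∀ i ∈ I, φ (t i) = 1 := by
  induction I using Finset.induction_on with
  | empty => exact ⟨0, by simp, by simp⟩
  | insert i I hi ih =>
    rw [Finset.card_insert_of_notMem hi, Finset.image_insert, Finset.insert_eq,
      Finset.coe_union, Submodule.span_union, Finset.coe_singleton,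
      sup_comm (Submodule.span K {t i}), ← sup_assoc] at h
    have h1 := finrank_sup_image_le (K := K) M t I
    have h2 : (I.image t).card ≤ I.card := Finset.card_image_le
    have h3 := Submodule.finrank_add_le_finrank_add_finrank
      (M ⊔ Submodule.span K (I.image t : Set W)) (Submodule.span K {t i})
    have h4 := finrank_span_single_le (K := K) (t i)
    obtain ⟨φ, hφ, hφ1⟩ := ih (by omega)
    have hnm : t i ∉ M ⊔ Submodule.span K (I.image t : Set W) := by
      intro hm
      rw [sup_eq_left.2 ((Submodule.span_singleton_le_iff_mem _ _).2 hm)] at h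
      omega
    obtain ⟨ψ, hψ0, hψ⟩ := Submodule.exists_le_ker_of_notMem hnm
    have hψ' : ∀ x ∈ M ⊔ Submodule.span K (I.image t : Set W), ψ x = 0 := fun x hx => hψ hx
    refine ⟨φ + ((1 - φ (t i)) * (ψ (t i))⁻¹) • ψ, ?_, ?_⟩
    · intro x hx
      have := hψ' x ((le_sup_left : M ≤ _) hx)
      simp [hφ x hx, this]
    · intro j hj
      rcases Finset.mem_insert.1 hj with rfl | hj
      · simp [hψ0]
      · have := hψ' (t j) ((le_sup_right : Submodule.span K (I.image t : Set W) ≤ _)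
          (Submodule.subset_span (by simpa using ⟨j, hj, rfl⟩)))
        simp [hφ1 j hj, this]

lemma indep_card {V α : Type*} [Fintype V] [Fintype α] [DecidableEq V] [DecidableEq α]
    (N : Finset V) (A B : Finset (V → α))
    (hA : ∀ f g : V → α, (∀ x ∈ N, f x = g x) → f ∈ A → g ∈ A)
    (hB : ∀ f g : V → α, (∀ x, x ∉ N → f x = g x) → f ∈ B → g ∈ B) :
    (A ∩ B).card * Fintype.card (V → α) = A.card * B.card := by
  rw [← Finset.card_univ, ← Finset.card_product, ← Finset.card_product]
  refine Finset.card_nbij' (fun p => (N.piecewise p.1 p.2, N.piecewise p.2 p.1))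
    (fun p => (N.piecewise p.1 p.2, N.piecewise p.2 p.1)) ?_ ?_ ?_ ?_
  · rintro ⟨f, g⟩ h
    simp only [Finset.coe_product, Set.mem_prod, Finset.mem_coe, Finset.mem_inter] at h ⊢
    refine ⟨hA f _ (fun x hx => by simp [hx]) h.1.1, hB f _ (fun x hx => by simp [hx]) h.1.2⟩
  · rintro ⟨f, g⟩ h
    simp only [Finset.coe_product, Set.mem_prod, Finset.mem_coe, Finset.mem_inter] at h ⊢
    refine ⟨⟨hA f _ (fun x hx => by simp [hx]) h.1, hB g _ (fun x hx => by simp [hx]) h.2⟩, by simp⟩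
  · rintro ⟨f, g⟩ h
    ext x <;> by_cases hx : x ∈ N <;> simp [hx]
  · rintro ⟨f, g⟩ h
    ext x <;> by_cases hx : x ∈ N <;> simp [hx]

lemma local_lemma {V α ι : Type*} [Fintype V] [Fintype α] [Nonempty α] [Fintype ι]
    [DecidableEq V] [DecidableEq α] [DecidableEq ι]
    (A : ι → Finset (V → α)) (N : ι → Finset V)
    (hA : ∀ i, ∀ f g : V → α, (∀ x ∈ N i, f x = g x) → f ∈ A i → g ∈ A i)
    (p d : ℝ) (hp0 : 0 ≤ p) (hp1 : 2 * p < 1) (hpd : 4 * p * d ≤ 1)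
    (hp : ∀ i, ((A i).card : ℝ) ≤ p * Fintype.card (V → α))
    (hd : ∀ i, ((univ.filter (fun j => ¬ Disjoint (N i) (N j))).card : ℝ) ≤ d) :
    ∃ f : V → α, ∀ i, f ∉ A i := by
  classical
  let good : Finset ι → Finset (V → α) := fun S => univ.filter (fun f => ∀ j ∈ S, f ∉ A j)
  have hΩ : (0 : ℝ) < Fintype.card (V → α) := by exact_mod_cast Fintype.card_pos
  have key : ∀ n : ℕ, ∀ S : Finset ι, S.card = n → ∀ i,
      ((A i ∩ good S).card : ℝ) ≤ 2 * p * (good S).card := by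
    intro n
    induction n using Nat.strong_induction_on with
    | _ n ih =>
    intro S hS i
    set S1 := S.filter (fun j => ¬ Disjoint (N i) (N j)) with hS1
    set S2 := S.filter (fun j => Disjoint (N i) (N j)) with hS2
    have hsub : good S ⊆ good S2 := by
      intro f hf
      simp only [good, Finset.mem_filter, Finset.mem_univ, true_and] at hf ⊢
      exact fun j hj => hf j (Finset.mem_filter.1 hj).1
    have h1 : ((A i ∩ good S2).card : ℝ) ≤ p * (good S2).card := by
      have := indep_card (N i) (A i) (good S2) (hA i) (by
        intro f g hfg hf
        simp only [good, Finset.mem_filter, Finset.mem_univ, true_and] at hf ⊢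
        intro j hj hg
        refine hf j hj (hA j g f (fun x hx => (hfg x ?_).symm) hg)
        intro hxi
        exact Finset.disjoint_left.1 (Finset.mem_filter.1 hj).2 hxi hx)
      have h' : ((A i ∩ good S2).card : ℝ) * Fintype.card (V → α) =
        (A i).card * (good S2).card := by exact_mod_cast this
      have h'' : ((A i).card : ℝ) * (good S2).card ≤ p * Fintype.card (V → α) * (good S2).card :=
        mul_le_mul_of_nonneg_right (hp i) (by positivity)
      refine le_of_mul_le_mul_right ?_ hΩ
      rw [h']; linarith
    have h2 : ((A i ∩ good S).card : ℝ) ≤ (A i ∩ good S2).card := by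
      exact_mod_cast Finset.card_le_card (Finset.inter_subset_inter_left hsub)
    have h3 : ((good S2).card : ℝ) ≤ 2 * (good S).card := by
      rcases S1.eq_empty_or_nonempty with he | hne
      · have : S2 = S := by
          ext j
          simp only [hS2, Finset.mem_filter, and_iff_left_iff_imp]
          intro hj
          by_contra hcon
          have : j ∈ S1 := by simp [hS1, hj, hcon]
          simp [he] at this
        rw [this]
        have : (0 : ℝ) ≤ (good S).card := by positivity
        linarith
      · have hlt : S2.card < n := by
          have := Finset.card_filter_add_card_filter_not (s := S) (fun j => Disjoint (N i) (N j))
          have hpos := hne.card_pos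
          rw [← hS1, ← hS2] at this
          omega
        have hcov : good S2 ⊆ good S ∪ S1.biUnion (fun j => A j ∩ good S2) := by
          intro f hf
          by_cases hfS : f ∈ good S
          · exact Finset.mem_union_left _ hfS
          · apply Finset.mem_union_right
            simp only [good, Finset.mem_filter, Finset.mem_univ, true_and, not_forall,
              not_not] at hfS
            obtain ⟨j, hj, hfj⟩ := hfS
            refine Finset.mem_biUnion.2 ⟨j, ?_, Finset.mem_inter.2 ⟨hfj, hf⟩⟩
            simp only [hS1, Finset.mem_filter]
            refine ⟨hj, fun hdis => ?_⟩
            simp only [good, Finset.mem_filter, Finset.mem_univ, true_and] at hf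
            exact hf j (Finset.mem_filter.2 ⟨hj, hdis⟩) hfj
        have hc1 : ((good S2).card : ℝ) ≤ (good S).card + ∑ j ∈ S1, ((A j ∩ good S2).card : ℝ) := by
          have := (Finset.card_le_card hcov).trans ((Finset.card_union_le _ _).trans
            (Nat.add_le_add_left Finset.card_biUnion_le _))
          exact_mod_cast this
        have hc2 : ∑ j ∈ S1, ((A j ∩ good S2).card : ℝ) ≤ S1.card * (2 * p * (good S2).card) := by
          rw [← nsmul_eq_mul]
          exact Finset.sum_le_card_nsmul _ _ _ (fun j _ => ih _ hlt S2 rfl j)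
        have hc3 : (S1.card : ℝ) ≤ d := by
          refine le_trans ?_ (hd i)
          exact_mod_cast Finset.card_le_card (Finset.filter_subset_filter _ (Finset.subset_univ S))
        have hc4 : (S1.card : ℝ) * (2 * p * (good S2).card) ≤ d * (2 * p * (good S2).card) :=
          mul_le_mul_of_nonneg_right hc3 (by positivity)
        have hc5 : 4 * p * d * (good S2).card ≤ 1 * (good S2).card :=
          mul_le_mul_of_nonneg_right hpd (by positivity)
        linarith
    have := mul_le_mul_of_nonneg_left h3 hp0
    linarith
  have hpos : ∀ S : Finset ι, (0 : ℝ) < (good S).card := by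
    intro S
    induction S using Finset.induction_on with
    | empty => simpa [good] using hΩ
    | insert i S hi ih =>
      have hcov : good S ⊆ good (insert i S) ∪ (A i ∩ good S) := by
        intro f hf
        by_cases hfi : f ∈ A i
        · exact Finset.mem_union_right _ (Finset.mem_inter.2 ⟨hfi, hf⟩)
        · apply Finset.mem_union_left
          simp only [good, Finset.mem_filter, Finset.mem_univ, true_and,
            Finset.mem_insert, forall_eq_or_imp] at hf ⊢
          exact ⟨hfi, hf⟩
      have hc : ((good S).card : ℝ) ≤ (good (insert i S)).card + (A i ∩ good S).card := by
        exact_mod_cast (Finset.card_le_card hcov).trans (Finset.card_union_le _ _)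
      have := key _ S rfl i
      nlinarith
  have h := hpos univ
  have h' : 0 < (good univ).card := by exact_mod_cast h
  obtain ⟨f, hf⟩ := Finset.card_pos.1 h'
  simp only [good, Finset.mem_filter, Finset.mem_univ, true_and, forall_true_left] at hf
  exact ⟨f, hf⟩


open Module in
lemma bad_vertex {W : Type*} [AddCommGroup W] [Module (ZMod 2) W] [FiniteDimensional (ZMod 2) W]
    (e : W ≃ₗ[ZMod 2] (W →ₗ[ZMod 2] ZMod 2)) (k : ℕ) (hk : 4 * k < finrank (ZMod 2) W)
    (f : W → Fin k) :
    ∃ v : W, v ≠ 0 ∧ ∀ c : Fin k,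
      (∃ w1 w2 : W, w1 ≠ w2 ∧ f w1 = c ∧ f w2 = c ∧ e v w1 = 1 ∧ e v w2 = 1) ∨
      ((∀ w, f w = c → e v w = 0) ∧ f v ≠ c) := by
  classical
  let C : Fin k → Set W := fun c => {w | f w = c}
  let sp : Finset (Fin k) → Submodule (ZMod 2) W := fun J =>
    Submodule.span (ZMod 2) (⋃ c ∈ J, C c)
  obtain ⟨J, hJ, hmax⟩ := Finset.exists_max_image
    (univ.filter (fun J : Finset (Fin k) => finrank (ZMod 2) (sp J) ≤ 2 * J.card))
    (fun J => J.card) ⟨∅, by simp [sp]⟩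
  simp only [Finset.mem_filter, Finset.mem_univ, true_and] at hJ hmax
  obtain ⟨t, htC, ht⟩ := rado_aux (K := ZMod 2) (fun i : Fin k × Bool => C i.1) _
    (Jᶜ ×ˢ univ) rfl (sp J) (by
      intro J' hJ'
      rcases J'.eq_empty_or_nonempty with rfl | hne
      · simpa using Submodule.finrank_mono le_sup_left
      have hd : Disjoint J (J'.image Prod.fst) := by
        rw [Finset.disjoint_left]
        intro c hc hc'
        obtain ⟨i, hi, rfl⟩ := Finset.mem_image.1 hc'
        have := hJ' hi
        simp at this
        exact this hc
      have hcard : J'.card ≤ (J'.image Prod.fst).card * 2 := by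
        have : J' ⊆ (J'.image Prod.fst) ×ˢ (univ : Finset Bool) := by
          intro i hi
          exact Finset.mem_product.2 ⟨Finset.mem_image_of_mem _ hi, Finset.mem_univ _⟩
        simpa using Finset.card_le_card this
      have heq : sp J ⊔ Submodule.span (ZMod 2) (⋃ i ∈ J', C i.1) =
          sp (J ∪ J'.image Prod.fst) := by
        simp only [sp]
        rw [Finset.set_biUnion_union, Submodule.span_union, Finset.set_biUnion_finset_image]
      rw [heq]
      have hpos : 0 < (J'.image Prod.fst).card := (hne.image _).card_pos
      have hu := Finset.card_union_of_disjoint hd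
      by_contra hcon
      have := hmax (J ∪ J'.image Prod.fst) (by omega)
      omega)
  have hle := finrank_sup_image_le (K := ZMod 2) (sp J) t (Jᶜ ×ˢ univ)
  have hcle : ((Jᶜ ×ˢ (univ : Finset Bool)).image t).card ≤ (Jᶜ ×ˢ (univ : Finset Bool)).card :=
    Finset.card_image_le
  have hinj : Set.InjOn t (Jᶜ ×ˢ (univ : Finset Bool) : Finset (Fin k × Bool)) := by
    rw [← Finset.card_image_iff]
    omega
  have hI : (Jᶜ ×ˢ (univ : Finset Bool)).card = (k - J.card) * 2 := by
    simp [Finset.card_compl]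
  have hJk : J.card ≤ k := by simpa using Finset.card_le_univ J
  obtain ⟨φ, hφ0, hφ1⟩ := exists_dual_one (sp J) t _ ht
  set P := sp J ⊔ Submodule.span (ZMod 2)
    ((Jᶜ ×ˢ (univ : Finset Bool)).image t : Set W) with hP
  obtain ⟨v, hvM, hv0, hv1⟩ : ∃ v, v ∉ sp J ∧ (∀ x ∈ sp J, e v x = 0) ∧
      ∀ i ∈ Jᶜ ×ˢ (univ : Finset Bool), e v (t i) = 1 := by
    by_cases h0 : e.symm φ ∈ sp J
    · have hnle : ¬ (P.dualAnnihilator.map (e.symm : (W →ₗ[ZMod 2] ZMod 2) →ₗ[ZMod 2] W)) ≤ sp J := by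
        intro hcon
        have h1 := Submodule.finrank_mono hcon
        have h2 : finrank (ZMod 2)
          (P.dualAnnihilator.map (e.symm : (W →ₗ[ZMod 2] ZMod 2) →ₗ[ZMod 2] W)) =
            finrank (ZMod 2) P.dualAnnihilator := LinearEquiv.finrank_map_eq e.symm _
        have h3 := Subspace.finrank_add_finrank_dualAnnihilator_eq P
        omega
      obtain ⟨u, hu, huM⟩ := Set.not_subset.1 hnle
      obtain ⟨ψ, hψ, rfl⟩ := hu
      have hψ' : ∀ x ∈ P, ψ x = 0 := fun x hx => (Submodule.mem_dualAnnihilator ψ).1 hψ x hx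
      refine ⟨e.symm (φ + ψ), ?_, ?_, ?_⟩
      · intro hcon
        apply huM
        rw [map_add] at hcon
        exact (Submodule.add_mem_iff_right _ h0).1 hcon
      · intro x hx
        have := hψ' x ((le_sup_left : sp J ≤ P) hx)
        simp [hφ0 x hx, this]
      · intro i hi
        have := hψ' (t i) ((le_sup_right : Submodule.span (ZMod 2)
          ((Jᶜ ×ˢ (univ : Finset Bool)).image t : Set W) ≤ P)
          (Submodule.subset_span (Finset.mem_coe.2 (Finset.mem_image_of_mem t hi))))
        simp [hφ1 i hi, this]
    · exact ⟨e.symm φ, h0, by simpa using hφ0, fun i hi => by simpa using hφ1 i hi⟩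
  refine ⟨v, fun h => hvM (h ▸ Submodule.zero_mem _), fun c => ?_⟩
  by_cases hc : c ∈ J
  · right
    have hsub : ∀ w, f w = c → w ∈ sp J := fun w hw =>
      Submodule.subset_span (Set.mem_biUnion hc hw)
    exact ⟨fun w hw => hv0 w (hsub w hw), fun h => hvM (hsub v h)⟩
  · left
    have m1 : (c, true) ∈ Jᶜ ×ˢ (univ : Finset Bool) := by simp [hc]
    have m2 : (c, false) ∈ Jᶜ ×ˢ (univ : Finset Bool) := by simp [hc]
    refine ⟨t (c, true), t (c, false), ?_, htC _ m1, htC _ m2, hv1 _ m1, hv1 _ m2⟩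
    intro h
    have := hinj (Finset.mem_coe.2 m1) (Finset.mem_coe.2 m2) h
    simp at this

abbrev SympW (s : ℕ) : Type := (Fin s → ZMod 2) × (Fin s → ZMod 2)

def sympForm (s : ℕ) : SympW s →ₗ[ZMod 2] (SympW s →ₗ[ZMod 2] ZMod 2) :=
  LinearMap.mk₂ (ZMod 2) (fun v w => v.1 ⬝ᵥ w.2 + w.1 ⬝ᵥ v.2)
    (by intro a b c; simp [add_dotProduct, dotProduct_add]; ring)
    (by intro a b c; simp [mul_add])
    (by intro a b c; simp [add_dotProduct, dotProduct_add]; ring)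
    (by intro a b c; simp [mul_add])

lemma sympForm_apply (s : ℕ) (v w : SympW s) :
    sympForm s v w = v.1 ⬝ᵥ w.2 + w.1 ⬝ᵥ v.2 := rfl

lemma sympForm_symm (s : ℕ) (v w : SympW s) : sympForm s v w = sympForm s w v := by
  rw [sympForm_apply, sympForm_apply, add_comm]

lemma sympForm_self (s : ℕ) (v : SympW s) : sympForm s v v = 0 := by
  rw [sympForm_apply]; exact CharTwo.add_self_eq_zero _

lemma sympForm_injective (s : ℕ) : Function.Injective (sympForm s) := by
  rw [← LinearMap.ker_eq_bot, LinearMap.ker_eq_bot']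
  intro v hv
  have h : ∀ w, sympForm s v w = 0 := fun w => by rw [hv]; rfl
  ext j
  · have := h (0, Pi.single j 1)
    simpa [sympForm_apply] using this
  · have := h (Pi.single j 1, 0)
    simpa [sympForm_apply] using this

noncomputable def sympEquiv (s : ℕ) : SympW s ≃ₗ[ZMod 2] (SympW s →ₗ[ZMod 2] ZMod 2) :=
  LinearEquiv.ofInjectiveOfFinrankEq (sympForm s) (sympForm_injective s)
    (Subspace.dual_finrank_eq).symm

lemma sympEquiv_apply (s : ℕ) (v w : SympW s) : sympEquiv s v w = sympForm s v w := rfl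

def sympGraph (s : ℕ) : SimpleGraph {v : SympW s // v ≠ 0} where
  Adj v w := sympForm s v.1 w.1 = 1
  symm := ⟨fun v w h => by rw [sympForm_symm]; exact h⟩
  loopless := ⟨fun v h => by rw [sympForm_self] at h; exact zero_ne_one h⟩

noncomputable instance (s : ℕ) : DecidableRel (sympGraph s).Adj := Classical.decRel _

lemma zmod_two_cases (x : ZMod 2) : x = 0 ∨ x = 1 := by
  revert x; decide

lemma sympGraph_degree (s : ℕ) (v : {v : SympW s // v ≠ 0}) :
    2 * (sympGraph s).degree v = 2 ^ (2 * s) := by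
  classical
  have h1 : (sympGraph s).degree v = (univ.filter (fun w : SympW s => sympForm s v.1 w = 1)).card := by
    rw [← SimpleGraph.card_neighborFinset_eq_degree]
    refine Finset.card_nbij (fun w => w.1) ?_ ?_ ?_
    · intro w hw
      have : (sympGraph s).Adj v w := by simpa using hw
      have h' : sympForm s v.1 w.1 = 1 := this
      simpa using h'
    · intro a _ b _ h; exact Subtype.ext h
    · intro w hw
      have hw' : sympForm s v.1 w = 1 := by simpa using hw
      refine ⟨⟨w, ?_⟩, ?_, rfl⟩
      · rintro rfl; simp at hw'
      · have : (sympGraph s).Adj v ⟨w, by rintro rfl; simp at hw'⟩ := hw'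
        simpa using this
  obtain ⟨w0, hw0⟩ : ∃ w0, sympForm s v.1 w0 = 1 := by
    by_contra hcon
    push Not at hcon
    apply v.2
    apply sympForm_injective s
    refine LinearMap.ext fun w => ?_
    rw [map_zero]
    exact (zmod_two_cases _).resolve_right (hcon w)
  have hself : w0 + w0 = 0 := by
    ext j
    · exact CharTwo.add_self_eq_zero _
    · exact CharTwo.add_self_eq_zero _
  have h2 : (univ.filter (fun w : SympW s => sympForm s v.1 w = 1)).card =
      (univ.filter (fun w : SympW s => ¬ sympForm s v.1 w = 1)).card := by
    refine Finset.card_nbij' (fun w => w + w0) (fun w => w + w0) ?_ ?_ ?_ ?_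
    · intro w hw
      have : sympForm s v.1 w = 1 := by simpa using hw
      simp [hw0, this]
    · intro w hw
      have : ¬ sympForm s v.1 w = 1 := by simpa using hw
      have := (zmod_two_cases _).resolve_right this
      simp [hw0, this]
    · intro w _; simp [add_assoc, hself]
    · intro w _; simp [add_assoc, hself]
  have h3 := Finset.card_filter_add_card_filter_not (s := (univ : Finset (SympW s)))
    (fun w => sympForm s v.1 w = 1)
  rw [← h2, ← h1] at h3
  have h4 : (univ : Finset (SympW s)).card = 2 ^ (2 * s) := by
    simp [Finset.card_univ, ZMod.card, two_mul, pow_add]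
  omega

lemma sympGraph_chi (s k : ℕ) (hs : 4 * k < 2 * s) (f : {v : SympW s // v ≠ 0} → Fin k) :
    ¬ IsCFCNColoring (sympGraph s) f := by
  classical
  intro hf
  rcases Nat.eq_zero_or_pos k with rfl | hk
  · obtain ⟨j⟩ : Nonempty (Fin s) := ⟨⟨0, by omega⟩⟩
    refine (f ⟨(Pi.single j 1, 0), ?_⟩).elim0
    intro h
    have := congrFun (congrArg Prod.fst h) j
    simp at this
  let g : SympW s → Fin k := fun w => if h : w ≠ 0 then f ⟨w, h⟩ else ⟨0, hk⟩
  have hg : ∀ w : {v : SympW s // v ≠ 0}, g w.1 = f w := fun w => by simp [g, w.2]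
  obtain ⟨v, hv0, hv⟩ := bad_vertex (sympEquiv s) k (by simp [Module.finrank_prod]; omega) g
  simp only [sympEquiv_apply] at hv
  obtain ⟨c, u, ⟨hu, huc⟩, huniq⟩ := hf ⟨v, hv0⟩
  rcases hv c with ⟨w1, w2, hne, hc1, hc2, h1, h2⟩ | ⟨hz, hvc⟩
  · have n1 : w1 ≠ 0 := by rintro rfl; simp at h1
    have n2 : w2 ≠ 0 := by rintro rfl; simp at h2
    have e1 := huniq ⟨w1, n1⟩ ⟨Set.mem_insert_of_mem _ h1, by rw [← hg]; exact hc1⟩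
    have e2 := huniq ⟨w2, n2⟩ ⟨Set.mem_insert_of_mem _ h2, by rw [← hg]; exact hc2⟩
    exact hne (congrArg Subtype.val (e1.trans e2.symm))
  · rcases hu with rfl | hu
    · exact hvc (by rw [← huc]; exact hg ⟨v, hv0⟩)
    · have := hz u.1 (by rw [hg]; exact huc)
      have h1 : sympForm s v u.1 = 1 := hu
      rw [this] at h1
      exact zero_ne_one h1

lemma exists_coloring {V : Type} [Fintype V] (G : SimpleGraph V) :
    {k : ℕ | ∃ f : V → Fin k, IsCFCNColoring G f}.Nonempty := by
  refine ⟨Fintype.card V, Fintype.equivFin V, fun v => ⟨Fintype.equivFin V v, v, ?_, ?_⟩⟩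
  · simp
  · intro u hu
    exact (Fintype.equivFin V).injective hu.2

lemma lower_part (c : ℝ) : c ≤ 1 → ∃ c' : ℝ, 0 < c' ∧ ∀ Δ₀ : ℕ, ∃ (V : Type) (_ : Fintype V)
        (G : SimpleGraph V) (_ : DecidableRel G.Adj),
        Δ₀ ≤ G.maxDegree ∧
        (∀ v : V, c * G.maxDegree ≤ (G.degree v : ℝ)) ∧
        c' * Real.log G.maxDegree ≤ (chiCN G : ℝ) := by
  classical
  intro hc
  refine ⟨1 / 4, by norm_num, fun Δ₀ => ?_⟩
  set s := Δ₀ + 1 with hs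
  have hdeg : ∀ v, (sympGraph s).degree v = 2 ^ (2 * s - 1) := by
    intro v
    have := sympGraph_degree s v
    have h2 : 2 ^ (2 * s) = 2 * 2 ^ (2 * s - 1) := by
      rw [← pow_succ']; congr 1
    omega
  have hne : Nonempty {v : SympW s // v ≠ 0} := by
    refine ⟨⟨(Pi.single (⟨0, by omega⟩ : Fin s) 1, 0), ?_⟩⟩
    intro h
    have := congrFun (congrArg Prod.fst h) (⟨0, by omega⟩ : Fin s)
    simp at this
  have hmax : (sympGraph s).maxDegree = 2 ^ (2 * s - 1) := by
    obtain ⟨v, hv⟩ := (sympGraph s).exists_maximal_degree_vertex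
    rw [hv, hdeg]
  refine ⟨_, inferInstance, sympGraph s, inferInstance, ?_, ?_, ?_⟩
  · rw [hmax]
    have : 2 * s - 1 < 2 ^ (2 * s - 1) := Nat.lt_two_pow_self
    omega
  · intro v
    rw [hmax, hdeg]
    exact mul_le_of_le_one_left (by positivity) hc
  · rw [hmax]
    have hchi : 2 * s ≤ 4 * chiCN (sympGraph s) := by
      by_contra hcon
      obtain ⟨f, hf⟩ := Nat.sInf_mem (exists_coloring (sympGraph s))
      exact sympGraph_chi s _ (not_le.1 hcon) f hf
    have hchi' : 2 * (s : ℝ) ≤ 4 * chiCN (sympGraph s) := by exact_mod_cast hchi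
    push_cast
    rw [Real.log_pow]
    have hl : Real.log 2 ≤ 1 := by
      have := Real.log_two_lt_d9; linarith
    have h1 : ((2 * s - 1 : ℕ) : ℝ) ≤ 2 * s := by
      exact_mod_cast Nat.sub_le _ _
    have h2 : ((2 * s - 1 : ℕ) : ℝ) * Real.log 2 ≤ ((2 * s - 1 : ℕ) : ℝ) * 1 :=
      mul_le_mul_of_nonneg_left hl (by positivity)
    linarith

lemma sum_update_eq {V α : Type*} [Fintype V] [Fintype α] [DecidableEq V] (F : (V → α) → ℝ)
    (a : V) :
    ∑ f : V → α, ∑ c : α, F (Function.update f a c) = Fintype.card α * ∑ f : V → α, F f := by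
  have hinv : Function.Involutive
      (fun p : (V → α) × α => (Function.update p.1 a p.2, p.1 a)) := by
    rintro ⟨f, c⟩
    simp
  calc ∑ f : V → α, ∑ c : α, F (Function.update f a c)
      = ∑ p : (V → α) × α, F (Function.update p.1 a p.2) := by
        rw [Fintype.sum_prod_type]
    _ = ∑ p : (V → α) × α, F p.1 := Equiv.sum_comp hinv.toPerm (fun p => F p.1)
    _ = _ := by
        rw [Fintype.sum_prod_type]
        simp [Finset.mul_sum]

lemma sum_weight_le {V α : Type*} [Fintype V] [Fintype α] [DecidableEq V]
    (w : Finset V → (V → α) → ℝ) (β : ℝ) (hβ : 0 ≤ β)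
    (hstep : ∀ N a, a ∉ N → ∀ f : V → α, ∑ c, w (insert a N) (Function.update f a c) ≤ β * w N f)
    (N : Finset V) :
    (Fintype.card α : ℝ) ^ N.card * ∑ f, w N f ≤ β ^ N.card * ∑ f, w ∅ f := by
  induction N using Finset.induction_on with
  | empty => simp
  | insert a N ha ih =>
    rw [Finset.card_insert_of_notMem ha, pow_succ, mul_assoc, ← sum_update_eq _ a]
    calc (Fintype.card α : ℝ) ^ N.card * ∑ f, ∑ c, w (insert a N) (Function.update f a c)
        ≤ (Fintype.card α : ℝ) ^ N.card * ∑ f, β * w N f :=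
          mul_le_mul_of_nonneg_left (Finset.sum_le_sum fun f _ => hstep N a ha f) (by positivity)
      _ = β * ((Fintype.card α : ℝ) ^ N.card * ∑ f, w N f) := by
          rw [← Finset.mul_sum]; ring
      _ ≤ β * (β ^ N.card * ∑ f, w ∅ f) := mul_le_mul_of_nonneg_left ih hβ
      _ = _ := by ring

/-- Number of vertices of `N` with a real color. -/
def cntT {V : Type*} {k m : ℕ} (N : Finset V) (f : V → Fin k ⊕ Fin m) : ℕ :=
  (N.filter (fun x => (f x).isLeft)).card

/-- The set of real colors seen in `N`. -/
def colR {V : Type*} {k m : ℕ} (N : Finset V) (f : V → Fin k ⊕ Fin m) : Finset (Fin k ⊕ Fin m) :=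
  (N.image f).filter (fun x => x.isLeft)

section
variable {V : Type*} [DecidableEq V] {k m : ℕ}

lemma cntT_update (N : Finset V) (a : V) (ha : a ∉ N) (f : V → Fin k ⊕ Fin m)
    (c : Fin k ⊕ Fin m) : cntT (insert a N) (Function.update f a c) =
      cntT N f + if c.isLeft then 1 else 0 := by
  unfold cntT
  have h : N.filter (fun x => (Function.update f a c x).isLeft) =
      N.filter (fun x => (f x).isLeft) := by
    apply Finset.filter_congr
    intro x hx
    have hxa : x ≠ a := by rintro rfl; exact ha hx
    rw [Function.update_of_ne hxa]
  rw [Finset.filter_insert, Function.update_self, h]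
  split_ifs with hc
  · rw [Finset.card_insert_of_notMem (by simp [ha])]
  · simp

lemma colR_update (N : Finset V) (a : V) (ha : a ∉ N) (f : V → Fin k ⊕ Fin m)
    (c : Fin k ⊕ Fin m) : colR (insert a N) (Function.update f a c) =
      if c.isLeft then insert c (colR N f) else colR N f := by
  unfold colR
  have h : N.image (Function.update f a c) = N.image f := by
    apply Finset.image_congr
    intro x hx
    have hxa : x ≠ a := by rintro rfl; exact ha hx
    exact Function.update_of_ne hxa _ _
  rw [Finset.image_insert, Function.update_self, h, Finset.filter_insert]

lemma card_colR (N : Finset V) (f : V → Fin k ⊕ Fin m) :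
    (univ.filter (fun i : Fin k => Sum.inl i ∈ colR N f)).card = (colR N f).card := by
  refine Finset.card_nbij (fun i => Sum.inl i) ?_ ?_ ?_
  · intro i hi; simpa using hi
  · intro i _ j _ h; exact Sum.inl_injective h
  · rintro (i | i) hi
    · exact ⟨i, by simpa using hi, rfl⟩
    · simp [colR] at hi

/-- first weight -/
noncomputable def wOne (q : ℕ) (N : Finset V) (f : V → Fin k ⊕ Fin m) : ℝ :=
  if (colR N f).card ≤ q then 2 ^ cntT N f / 4 ^ (colR N f).card else 0

lemma wOne_nonneg (q : ℕ) (N : Finset V) (f : V → Fin k ⊕ Fin m) : 0 ≤ wOne q N f := by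
  unfold wOne; split_ifs <;> positivity

lemma wOne_step (q : ℕ) (N : Finset V) (a : V) (ha : a ∉ N) (f : V → Fin (6 * q) ⊕ Fin m) :
    ∑ c, wOne q (insert a N) (Function.update f a c) ≤ (m + 9 / 2 * q) * wOne q N f := by
  have hw := wOne_nonneg q N f
  have hr : ∀ i : Fin m, wOne q (insert a N) (Function.update f a (Sum.inr i)) = wOne q N f := by
    intro i
    simp [wOne, cntT_update N a ha, colR_update N a ha]
  have hl : ∀ i : Fin (6 * q), wOne q (insert a N) (Function.update f a (Sum.inl i)) ≤
      wOne q N f / 2 + if Sum.inl i ∈ colR N f then 3 / 2 * wOne q N f else 0 := by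
    intro i
    unfold wOne
    rw [cntT_update N a ha, colR_update N a ha]
    simp only [Sum.isLeft_inl, if_true]
    by_cases hi : Sum.inl i ∈ colR N f
    · rw [Finset.insert_eq_of_mem hi]
      simp only [hi, if_true]
      split_ifs
      · apply le_of_eq; rw [pow_succ]; ring
      · simp
    · rw [Finset.card_insert_of_notMem hi]
      simp only [hi, if_false]
      split_ifs with h1 h2
      · apply le_of_eq; rw [pow_succ, pow_succ]; ring
      · omega
      · positivity
      · simp
  rw [Fintype.sum_sum_type]
  simp only [hr]
  have h1 := Finset.sum_le_sum (fun i (_ : i ∈ (univ : Finset (Fin (6 * q)))) => hl i)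
  rw [Finset.sum_add_distrib, ← Finset.sum_filter, Finset.sum_const, Finset.sum_const,
    card_colR, Finset.card_univ, Fintype.card_fin, nsmul_eq_mul, nsmul_eq_mul] at h1
  rw [Finset.sum_const, Finset.card_univ, Fintype.card_fin, nsmul_eq_mul]
  have h2 : ((colR N f).card : ℝ) * wOne q N f ≤ q * wOne q N f := by
    by_cases h : (colR N f).card ≤ q
    · exact mul_le_mul_of_nonneg_right (by exact_mod_cast h) hw
    · simp [wOne, h]
  push_cast at h1
  linarith

lemma wTwo_step (N : Finset V) (a : V) (ha : a ∉ N) (f : V → Fin k ⊕ Fin m) :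
    ∑ c, (2 : ℝ) ^ cntT (insert a N) (Function.update f a c) ≤ (m + 2 * k) * 2 ^ cntT N f := by
  rw [Fintype.sum_sum_type]
  simp only [cntT_update N a ha]
  simp [pow_succ]
  apply le_of_eq
  ring

lemma bad_cnt (N : Finset V) (f : V → Fin k ⊕ Fin m)
    (hbad : ∀ i : Fin k, ¬ ∃! u, u ∈ N ∧ f u = Sum.inl i) :
    2 * (colR N f).card ≤ cntT N f := by
  unfold cntT
  rw [Finset.card_eq_sum_card_fiberwise (f := f) (t := colR N f)]
  · rw [mul_comm, ← smul_eq_mul]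
    apply Finset.card_nsmul_le_sum
    intro c hc
    simp only [colR, Finset.mem_filter, Finset.mem_image] at hc
    obtain ⟨⟨u, hu, rfl⟩, hl⟩ := hc
    obtain ⟨i, hi⟩ := Sum.isLeft_iff.1 hl
    have h1 := hbad i
    have : ∃ u', (u' ∈ N ∧ f u' = Sum.inl i) ∧ u' ≠ u := by
      by_contra hcon
      push Not at hcon
      exact h1 ⟨u, ⟨hu, hi⟩, fun y hy => hcon y hy⟩
    obtain ⟨u', ⟨hu', hi'⟩, hne⟩ := this
    refine Nat.succ_le_of_lt (Finset.one_lt_card.2 ⟨u, ?_, u', ?_, hne.symm⟩)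
    · simp [hu, hi]
    · simp [hu', hi, hi']
  · intro x hx
    have hx' : x ∈ N ∧ (f x).isLeft = true := by simpa using hx
    simp only [colR, Finset.coe_filter, Finset.mem_image, Set.mem_setOf_eq]
    exact ⟨⟨x, hx'.1, rfl⟩, hx'.2⟩

open Classical in
lemma bad_count [Fintype V] (q : ℕ) (N : Finset V) :
    ((univ.filter (fun f : V → Fin (6 * q) ⊕ Fin m =>
      ∀ i, ¬ ∃! u, u ∈ N ∧ f u = Sum.inl i)).card : ℝ) * (m + 6 * q : ℝ) ^ N.card ≤
    ((m + 9 / 2 * q) ^ N.card + (m + 12 * q) ^ N.card / 4 ^ q) *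
      Fintype.card (V → Fin (6 * q) ⊕ Fin m) := by
  have hM : (Fintype.card (Fin (6 * q) ⊕ Fin m) : ℝ) = m + 6 * q := by
    simp; ring
  have h1 := sum_weight_le (wOne (k := 6 * q) (m := m) (V := V) q) (m + 9 / 2 * q) (by positivity)
    (fun N a ha f => wOne_step q N a ha f) N
  have h2 := sum_weight_le (fun (N : Finset V) (f : V → Fin (6 * q) ⊕ Fin m) =>
    (2 : ℝ) ^ cntT N f) (m + 12 * q) (by positivity)
    (fun N a ha f => by
      refine (wTwo_step N a ha f).trans (le_of_eq ?_)
      push_cast; ring) N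
  rw [hM] at h1 h2
  have e1 : ∑ f : V → Fin (6 * q) ⊕ Fin m, wOne q (∅ : Finset V) f =
      Fintype.card (V → Fin (6 * q) ⊕ Fin m) := by
    simp [wOne, colR, cntT]
  have e2 : ∑ f : V → Fin (6 * q) ⊕ Fin m, (2 : ℝ) ^ cntT (∅ : Finset V) f =
      Fintype.card (V → Fin (6 * q) ⊕ Fin m) := by
    simp [cntT]
  rw [e1] at h1
  rw [e2] at h2
  have h3 : ((univ.filter (fun f : V → Fin (6 * q) ⊕ Fin m =>
      ∀ i, ¬ ∃! u, u ∈ N ∧ f u = Sum.inl i)).card : ℝ) ≤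
      ∑ f : V → Fin (6 * q) ⊕ Fin m, (wOne q N f + 2 ^ cntT N f / 4 ^ q) := by
    rw [Finset.card_eq_sum_ones, Nat.cast_sum]
    refine (Finset.sum_le_sum (g := fun f : V → Fin (6 * q) ⊕ Fin m =>
      wOne q N f + 2 ^ cntT N f / 4 ^ q) ?_).trans
      (Finset.sum_le_sum_of_subset_of_nonneg (Finset.subset_univ _) ?_)
    · intro f hf
      have hb := bad_cnt N f (by simpa using hf)
      by_cases hq : (colR N f).card ≤ q
      · have : (1 : ℝ) ≤ wOne q N f := by
          simp only [wOne, hq, if_true]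
          rw [one_le_div (by positivity)]
          calc (4 : ℝ) ^ (colR N f).card = 2 ^ (2 * (colR N f).card) := by rw [pow_mul]; norm_num
            _ ≤ _ := pow_le_pow_right₀ (by norm_num) hb
        have h' : (0 : ℝ) ≤ 2 ^ cntT N f / 4 ^ q := by positivity
        push_cast
        linarith
      · have : (1 : ℝ) ≤ 2 ^ cntT N f / 4 ^ q := by
          rw [one_le_div (by positivity)]
          calc (4 : ℝ) ^ q = 2 ^ (2 * q) := by rw [pow_mul]; norm_num
            _ ≤ _ := pow_le_pow_right₀ (by norm_num) (by omega)
        have h' := wOne_nonneg q N f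
        push_cast
        linarith
    · intro f _ _
      have h' := wOne_nonneg q N f
      positivity
  rw [Finset.sum_add_distrib, ← Finset.sum_div] at h3
  have h4 := mul_le_mul_of_nonneg_right h3
    (show (0 : ℝ) ≤ (m + 6 * q : ℝ) ^ N.card by positivity)
  refine h4.trans ?_
  have h5 := div_le_div_of_nonneg_right h2 (show (0 : ℝ) ≤ 4 ^ q by positivity)
  calc _ = (m + 6 * q : ℝ) ^ N.card * ∑ f : V → Fin (6 * q) ⊕ Fin m, wOne q N f +
        (m + 6 * q : ℝ) ^ N.card * (∑ f : V → Fin (6 * q) ⊕ Fin m, (2 : ℝ) ^ cntT N f) / 4 ^ q := by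
        ring
    _ ≤ _ := add_le_add h1 h5
    _ = _ := by ring

end

lemma prob_num (c D : ℝ) (q n : ℕ) (hc : 0 < c) (hc1 : c ≤ 1) (hD : 1 ≤ D) (m : ℕ)
    (hm : (m : ℝ) = 100 * D) (hq : 6 * (q : ℝ) ≤ 100 * D) (hn1 : c * D ≤ n) (hn2 : (n : ℝ) ≤ 2 * D) :
    ((m + 9 / 2 * q : ℝ) ^ n + (m + 12 * q) ^ n / 4 ^ q) ≤
      2 * Real.exp (-(c * q / 200)) * (m + 6 * q : ℝ) ^ n := by
  have hM : (0 : ℝ) < m + 6 * q := by rw [hm]; positivity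
  have hq0 : (0 : ℝ) ≤ q := by positivity
  have a1 : (m + 9 / 2 * q : ℝ) ^ n ≤ Real.exp (-(c * q / 200)) * (m + 6 * q : ℝ) ^ n := by
    have h1 : (m + 9 / 2 * q : ℝ) ≤ Real.exp (-(3 / 2 * q / (m + 6 * q))) * (m + 6 * q) := by
      have := Real.add_one_le_exp (-(3 / 2 * q / (m + 6 * q) : ℝ))
      calc (m + 9 / 2 * q : ℝ) = (-(3 / 2 * q / (m + 6 * q) : ℝ) + 1) * (m + 6 * q) := by
            rw [add_mul, neg_mul, div_mul_cancel₀ _ hM.ne']; ring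
        _ ≤ _ := mul_le_mul_of_nonneg_right this hM.le
    refine (pow_le_pow_left₀ (by positivity) h1 n).trans ?_
    rw [mul_pow, ← Real.exp_nat_mul]
    refine mul_le_mul_of_nonneg_right (Real.exp_le_exp.2 ?_) (by positivity)
    have h2 : c * q / 200 ≤ n * (3 / 2 * q / (m + 6 * q)) := by
      rw [← mul_div_assoc, div_le_div_iff₀ (by norm_num) hM]
      have h3 : c * q * (m + 6 * q) ≤ c * q * (200 * D) :=
        mul_le_mul_of_nonneg_left (by rw [hm]; linarith) (by positivity)
      have h4 : c * D * q ≤ n * q := mul_le_mul_of_nonneg_right hn1 hq0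
      nlinarith
    linarith
  have a2 : (m + 12 * q : ℝ) ^ n / 4 ^ q ≤ Real.exp (-(c * q / 200)) * (m + 6 * q : ℝ) ^ n := by
    have h1 : (m + 12 * q : ℝ) ≤ Real.exp (6 * q / (m + 6 * q)) * (m + 6 * q) := by
      have := Real.add_one_le_exp ((6 * q / (m + 6 * q) : ℝ))
      calc (m + 12 * q : ℝ) = ((6 * q / (m + 6 * q) : ℝ) + 1) * (m + 6 * q) := by
            rw [add_mul, div_mul_cancel₀ _ hM.ne']; ring
        _ ≤ _ := mul_le_mul_of_nonneg_right this hM.le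
    have h2 := pow_le_pow_left₀ (by positivity) h1 n
    rw [mul_pow, ← Real.exp_nat_mul] at h2
    have h3 : (n : ℝ) * (6 * q / (m + 6 * q)) ≤ 12 / 100 * q := by
      rw [← mul_div_assoc, div_le_iff₀ hM]
      have h4 : (n : ℝ) * q ≤ 2 * D * q := mul_le_mul_of_nonneg_right hn2 hq0
      rw [hm]
      nlinarith
    have h4 : Real.exp q ≤ 4 ^ q := by
      have : Real.exp q = Real.exp 1 ^ q := by rw [← Real.exp_nat_mul]; simp
      rw [this]
      refine pow_le_pow_left₀ (Real.exp_pos _).le ?_ q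
      have := Real.exp_one_lt_d9
      linarith
    rw [div_le_iff₀ (by positivity)]
    refine h2.trans ?_
    have h5 : Real.exp (n * (6 * q / (m + 6 * q))) ≤ Real.exp (-(c * q / 200)) * 4 ^ q := by
      refine le_trans ?_ (mul_le_mul_of_nonneg_left h4 (Real.exp_pos _).le)
      rw [← Real.exp_add]
      apply Real.exp_le_exp.2
      have : c * q ≤ 1 * q := mul_le_mul_of_nonneg_right hc1 hq0
      linarith
    calc _ ≤ Real.exp (-(c * q / 200)) * 4 ^ q * (m + 6 * q : ℝ) ^ n :=
          mul_le_mul_of_nonneg_right h5 (by positivity)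
      _ = _ := by ring
  linarith

lemma upper_core (c : ℝ) (hc : 0 < c) (hc1 : c ≤ 1) (q : ℕ) (V : Type) [Fintype V]
    (G : SimpleGraph V) [DecidableRel G.Adj] (hΔ : 32 ≤ G.maxDegree)
    (hq : 6 * q ≤ 100 * G.maxDegree) (hqL : 3 * Real.log G.maxDegree ≤ c * q / 200)
    (hdeg : ∀ v : V, c * G.maxDegree ≤ (G.degree v : ℝ)) : chiCN G ≤ 6 * q + 1 := by
  classical
  set D := G.maxDegree with hD
  have hDr : (32 : ℝ) ≤ D := by exact_mod_cast hΔ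
  let Nb : V → Finset V := fun v => insert v (G.neighborFinset v)
  have hNcard : ∀ v, (Nb v).card = G.degree v + 1 := by
    intro v
    simp only [Nb]
    rw [Finset.card_insert_of_notMem (by simp), SimpleGraph.card_neighborFinset_eq_degree]
  have hNle : ∀ v, (Nb v).card ≤ D + 1 := fun v => by
    rw [hNcard]; exact Nat.succ_le_succ (G.degree_le_maxDegree v)
  have hNsymm : ∀ u v, u ∈ Nb v ↔ v ∈ Nb u := by
    intro u v
    simp only [Nb, Finset.mem_insert, SimpleGraph.mem_neighborFinset]
    rw [eq_comm, G.adj_comm]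
  let A : V → Finset (V → Fin (6 * q) ⊕ Fin (100 * D)) := fun v =>
    univ.filter (fun f => ∀ i, ¬ ∃! u, u ∈ Nb v ∧ f u = Sum.inl i)
  haveI : Nonempty (Fin (6 * q) ⊕ Fin (100 * D)) := ⟨Sum.inr ⟨0, by omega⟩⟩
  have hexp : Real.exp (-(c * q / 200)) ≤ ((D : ℝ) ^ 3)⁻¹ := by
    have : ((D : ℝ) ^ 3)⁻¹ = Real.exp (-(3 * Real.log D)) := by
      rw [Real.exp_neg, ← Real.log_rpow (by positivity), Real.exp_log (by positivity)]
      norm_cast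
    rw [this]
    exact Real.exp_le_exp.2 (by linarith)
  have hexp' : Real.exp (-(c * q / 200)) * (D : ℝ) ^ 3 ≤ 1 := by
    have := mul_le_mul_of_nonneg_right hexp (show (0 : ℝ) ≤ (D : ℝ) ^ 3 by positivity)
    rwa [inv_mul_cancel₀ (by positivity)] at this
  have hexp0 := Real.exp_pos (-(c * q / 200))
  obtain ⟨f, hf⟩ := local_lemma A Nb
    (by
      intro v f g hfg hf
      simp only [A, Finset.mem_filter, Finset.mem_univ, true_and] at hf ⊢
      rintro i ⟨u, ⟨hu, hui⟩, huniq⟩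
      refine hf i ⟨u, ⟨hu, (hfg u hu).trans hui⟩, fun y hy => huniq y ⟨hy.1, ?_⟩⟩
      exact (hfg y hy.1).symm.trans hy.2)
    (2 * Real.exp (-(c * q / 200))) ((D + 1 : ℝ) ^ 2) (by positivity)
    (by
      have : (32 : ℝ) ^ 3 ≤ (D : ℝ) ^ 3 := pow_le_pow_left₀ (by norm_num) hDr 3
      nlinarith)
    (by
      have h1 : (8 : ℝ) * (D + 1) ^ 2 ≤ (D : ℝ) ^ 3 := by nlinarith
      nlinarith)
    (by
      intro v
      have h1 := bad_count (m := 100 * D) q (Nb v)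
      have h2 := prob_num c D q (Nb v).card hc hc1 (by linarith) (100 * D) (by push_cast; ring)
        (by exact_mod_cast hq) (by rw [hNcard]; push_cast; linarith [hdeg v])
        (by have : ((Nb v).card : ℝ) ≤ D + 1 := by exact_mod_cast hNle v
            linarith)
      have hM : (0 : ℝ) < (((100 * D : ℕ) : ℝ) + 6 * q) ^ (Nb v).card := by
        have : (0 : ℝ) < ((100 * D : ℕ) : ℝ) := by push_cast; linarith
        positivity
      refine le_of_mul_le_mul_right (h1.trans ?_) hM
      refine (mul_le_mul_of_nonneg_right h2 (by positivity)).trans (le_of_eq ?_)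
      ring)
    (by
      intro v
      have hsub : (univ.filter (fun j => ¬ Disjoint (Nb v) (Nb j))) ⊆ (Nb v).biUnion Nb := by
        intro u hu
        simp only [Finset.mem_filter, Finset.mem_univ, true_and] at hu
        obtain ⟨x, hx, hxu⟩ := Finset.not_disjoint_iff.1 hu
        exact Finset.mem_biUnion.2 ⟨x, hx, (hNsymm _ _).1 hxu⟩
      have h1 := (Finset.card_le_card hsub).trans
        (Finset.card_biUnion_le_card_mul _ _ (D + 1) (fun x _ => hNle x))
      have h2 : (Nb v).card * (D + 1) ≤ (D + 1) ^ 2 := by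
        rw [sq]; exact Nat.mul_le_mul_right _ (hNle v)
      exact_mod_cast h1.trans h2)
  apply Nat.sInf_le
  let h : Fin (6 * q) ⊕ Fin (100 * D) → Fin (6 * q + 1) :=
    Sum.elim Fin.castSucc (fun _ => Fin.last _)
  have hh : ∀ x i, h x = Fin.castSucc i ↔ x = Sum.inl i := by
    rintro (x | x) i
    · simp [h]
    · simp [h, (Fin.castSucc_lt_last i).ne']
  refine ⟨fun v => h (f v), fun v => ?_⟩
  have hv := hf v
  simp only [A, Finset.mem_filter, Finset.mem_univ, true_and, not_forall, not_not] at hv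
  obtain ⟨i, hi⟩ := hv
  refine ⟨Fin.castSucc i, ?_⟩
  simpa [hh, Nb] using hi

lemma upper_part (c : ℝ) (hc : 0 < c) : ∃ C : ℝ, 0 < C ∧ ∃ Δ₀ : ℕ, ∀ (V : Type) [Fintype V]
        (G : SimpleGraph V) [DecidableRel G.Adj],
        Δ₀ ≤ G.maxDegree →
        (∀ v : V, c * G.maxDegree ≤ (G.degree v : ℝ)) →
        (chiCN G : ℝ) ≤ C * Real.log G.maxDegree := by
  have hlit := Real.isLittleO_log_id_atTop.bound (show (0 : ℝ) < c / 100 by positivity)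
  obtain ⟨x0, hx0⟩ := Filter.eventually_atTop.1 hlit
  refine ⟨3600 / c + 7, by positivity, max 32 ⌈x0⌉₊, ?_⟩
  intro V _ G _ hΔ hdeg
  have h32 : 32 ≤ G.maxDegree := (le_max_left _ _).trans hΔ
  have hx : x0 ≤ G.maxDegree :=
    (Nat.le_ceil x0).trans (by exact_mod_cast (le_max_right _ _).trans hΔ)
  have hDr : (32 : ℝ) ≤ G.maxDegree := by exact_mod_cast h32
  have hne : Nonempty V := by
    by_contra hcon
    rw [not_nonempty_iff] at hcon
    have := G.maxDegree_le_of_forall_degree_le 0 (fun v => hcon.elim v)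
    omega
  have hc1 : c ≤ 1 := by
    obtain ⟨v⟩ := hne
    have h1 := hdeg v
    have h2 : (G.degree v : ℝ) ≤ G.maxDegree := by exact_mod_cast G.degree_le_maxDegree v
    by_contra hcon
    push Not at hcon
    nlinarith
  set L := Real.log G.maxDegree with hL
  have hL1 : 1 ≤ L := by
    rw [hL, Real.le_log_iff_exp_le (by linarith)]
    have := Real.exp_one_lt_d9
    linarith
  have hLle : L ≤ c / 100 * G.maxDegree := by
    have := hx0 _ hx
    simp only [id, Real.norm_eq_abs] at this
    rw [abs_of_nonneg (by linarith), abs_of_nonneg (by linarith)] at this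
    exact this
  set q := ⌈600 / c * L⌉₊ with hq
  have hq1 : 600 / c * L ≤ q := Nat.le_ceil _
  have hq2 : (q : ℝ) < 600 / c * L + 1 := Nat.ceil_lt_add_one (by positivity)
  have h1 : 600 / c * L ≤ 6 * G.maxDegree := by
    calc 600 / c * L ≤ 600 / c * (c / 100 * G.maxDegree) :=
          mul_le_mul_of_nonneg_left hLle (by positivity)
      _ = _ := by field_simp; ring
  have h6 : 6 * q ≤ 100 * G.maxDegree := by
    have : 6 * (q : ℝ) ≤ 100 * G.maxDegree := by linarith
    exact_mod_cast this
  have h7 : 3 * L ≤ c * q / 200 := by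
    have := mul_le_mul_of_nonneg_left hq1 hc.le
    have h8 : c * (600 / c * L) = 600 * L := by field_simp
    linarith
  have := upper_core c hc hc1 q V G h32 h6 h7 hdeg
  have h9 : (chiCN G : ℝ) ≤ 6 * q + 1 := by exact_mod_cast this
  have h10 : (3600 / c + 7) * L = 6 * (600 / c * L) + 7 * L := by ring
  linarith

theorem fCN_linear_min_degree (c : ℝ) (hc : 0 < c) :
    -- Upper bound: graphs with minimum degree at least c·Δ have χ_CN = O(ln Δ)
    (∃ C : ℝ, 0 < C ∧ ∃ Δ₀ : ℕ, ∀ (V : Type) [Fintype V]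
        (G : SimpleGraph V) [DecidableRel G.Adj],
        Δ₀ ≤ G.maxDegree →
        (∀ v : V, c * G.maxDegree ≤ (G.degree v : ℝ)) →
        (chiCN G : ℝ) ≤ C * Real.log G.maxDegree) ∧
    -- Lower bound: there exist such graphs with arbitrarily large Δ and χ_CN = Ω(ln Δ)
    (c ≤ 1 → ∃ c' : ℝ, 0 < c' ∧ ∀ Δ₀ : ℕ, ∃ (V : Type) (_ : Fintype V)
        (G : SimpleGraph V) (_ : DecidableRel G.Adj),
        Δ₀ ≤ G.maxDegree ∧
        (∀ v : V, c * G.maxDegree ≤ (G.degree v : ℝ)) ∧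
        c' * Real.log G.maxDegree ≤ (chiCN G : ℝ)) := by
  exact ⟨upper_part c hc, lower_part c⟩
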